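/- Let A : Diff_id^1(ℝ³) → 𝓛(V,V*) assign to each φ a bounded symmetric nonnegative operator, locally Lipschitz for the ‖·‖_{1,∞} distance, let ω > 0, and let j ∈ L¹([0,T],V*). If φ : [0,T₀] → Diff_id^1(ℝ³), T₀ ≤ T, is a solution of the control system φ(t) = id + ∫₀ᵗ v(s) ∘ φ(s) ds with v(s) = (ω K_V⁻¹ + A_{φ(s)})⁻¹ j(s), then for all t ∈ [0,T₀]: ‖φ(t) − id‖_{1,∞} ≤ B_j and ‖φ(t)⁻¹ − id‖_{1,∞} ≤ B_j, where B_j = (2c_V/ω) · ‖j‖_{L¹([0,T],V*)} · exp( (c_V/ω) ‖j‖_{L¹([0,T],V*)} ). -/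

import Mathlib

open MeasureTheory Filter Set
open scoped RealInnerProductSpace Topology

noncomputable section

/-- Euclidean 3-space. -/
abbrev E3 : Type := EuclideanSpace ℝ (Fin 3)

/-- The supremum over `ℝ³` of the norm of the `k`-th derivative of `v`. -/
def supDeriv (k : ℕ) (v : E3 → E3) : ℝ := ⨆ x : E3, ‖iteratedFDeriv ℝ k v x‖

/-- The norm `‖v‖_{s,∞} = Σ_{k ≤ s} sup_x |Dᵏ v(x)|`. -/
def normS (s : ℕ) (v : E3 → E3) : ℝ := ∑ k ∈ Finset.range (s + 1), supDeriv k v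

/-- The seminorm `‖v‖_{1,∞}^Ω = sup_{x ∈ Ω} |v(x)| + sup_{x ∈ Ω} |Dv(x)|`. -/
def normSOn (Ω : Set E3) (v : E3 → E3) : ℝ :=
  (⨆ x : Ω, ‖v (x : E3)‖) + ⨆ x : Ω, ‖fderiv ℝ v (x : E3)‖

/-- Membership in `C₀^s(ℝ³,ℝ³)`: `v` is `C^s` and all derivatives up to order `s`
tend to `0` at infinity. -/
def MemC0 (s : ℕ) (v : E3 → E3) : Prop :=
  ContDiff ℝ s v ∧
    ∀ k ≤ s, Tendsto (fun x => ‖iteratedFDeriv ℝ k v x‖) (cocompact E3) (𝓝 0)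

/-- `Diff_id^s(ℝ³)`: `C^s`-diffeomorphisms of `ℝ³` equal to the identity at infinity. -/
structure DiffId (s : ℕ) : Type where
  toFun : E3 → E3
  invFun : E3 → E3
  left_inv : Function.LeftInverse invFun toFun
  right_inv : Function.RightInverse invFun toFun
  memC0 : MemC0 s fun x => toFun x - x
  memC0_inv : MemC0 s fun x => invFun x - x

instance (s : ℕ) : CoeFun (DiffId s) fun _ => E3 → E3 := ⟨DiffId.toFun⟩

/-- The distance `‖φ − ψ‖_{s,∞}` on `Diff_id^s(ℝ³)`. -/
def distS (s : ℕ) (φ ψ : DiffId s) : ℝ := normS s fun x => φ x - ψ x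

/-- The set `𝔖_γ = {φ : ‖φ − id‖_{1,∞} ≤ γ and ‖φ⁻¹ − id‖_{1,∞} ≤ γ}`. -/
def Sgamma (γ : ℝ) : Set (DiffId 1) :=
  {φ | normS 1 (fun x => φ x - x) ≤ γ ∧ normS 1 (fun x => φ.invFun x - x) ≤ γ}

/-- `v` is the velocity `(ω K_V⁻¹ + B)⁻¹ j`, i.e. the unique minimizer of
`(ω/2)‖·‖² + (1/2)(B · | ·) − (j | ·)`:  `ω⟪v,w⟫ + (Bv|w) = (j|w)` for all `w`. -/
def IsVel {V : Type*} [NormedAddCommGroup V] [InnerProductSpace ℝ V]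
    (B : V →L[ℝ] V →L[ℝ] ℝ) (ω : ℝ) (j : V →L[ℝ] ℝ) (v : V) : Prop :=
  ∀ w : V, ω * ⟪v, w⟫ + B v w = j w

/-- `(φ, v)` solves the control system
`φ(t) = id + ∫₀ᵗ v(s) ∘ φ(s) ds`, `v(s) = (ω K_V⁻¹ + A_{φ(s)})⁻¹ j(s)` on `[0,T₀]`,
with `t ↦ φ(t)` continuous into `Diff_id¹(ℝ³)`. -/
def IsSolution {V : Type*} [NormedAddCommGroup V] [InnerProductSpace ℝ V]
    (emb : V →ₗ[ℝ] (E3 → E3)) (ω : ℝ) (A : DiffId 1 → V →L[ℝ] V →L[ℝ] ℝ)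
    (j : ℝ → V →L[ℝ] ℝ) (T₀ : ℝ) (φ : ℝ → DiffId 1) (v : ℝ → V) : Prop :=
  (∀ t ∈ Icc (0 : ℝ) T₀, IsVel (A (φ t)) ω (j t) (v t)) ∧
  (∀ t ∈ Icc (0 : ℝ) T₀, ∀ x : E3,
    IntervalIntegrable (fun s => emb (v s) (φ s x)) volume 0 t ∧
      φ t x = x + ∫ s in (0 : ℝ)..t, emb (v s) (φ s x)) ∧
  ∀ t₀ ∈ Icc (0 : ℝ) T₀,
    Tendsto (fun t => distS 1 (φ t) (φ t₀)) (𝓝[Icc (0 : ℝ) T₀] t₀) (𝓝 0)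


theorem aux_gronwall (a u : ℝ → ℝ) (b c : ℝ) (hb : 0 ≤ b) (hc : 0 ≤ c)
    (ha : IntervalIntegrable a volume 0 b) (ha0 : ∀ s ∈ Icc 0 b, 0 ≤ a s)
    (hu : ContinuousOn u (Icc 0 b)) (hu0 : ∀ s ∈ Icc 0 b, 0 ≤ u s)
    (h : ∀ s ∈ Icc 0 b, u s ≤ c + ∫ r in (0:ℝ)..s, a r * u r) :
    ∀ s ∈ Icc 0 b, u s ≤ c * Real.exp (∫ r in (0:ℝ)..s, a r) := by
  have hau : IntervalIntegrable (fun r => a r * u r) volume 0 b :=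
    ha.mul_continuousOn (by rwa [uIcc_of_le hb])
  have hsub : ∀ f : ℝ → ℝ, IntervalIntegrable f volume 0 b → ∀ s ∈ Icc 0 b, ∀ t ∈ Icc 0 b,
      IntervalIntegrable f volume s t := by
    intro f hf s hs t ht
    refine hf.mono_set ?_
    rw [uIcc_of_le hb]
    exact uIcc_subset_Icc hs ht
  have h0 : (0:ℝ) ∈ Icc 0 b := ⟨le_rfl, hb⟩
  set A : ℝ → ℝ := fun s => ∫ r in (0:ℝ)..s, a r with hA
  set F : ℝ → ℝ := fun s => c + ∫ r in (0:ℝ)..s, a r * u r with hF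
  have hAc : ContinuousOn A (Icc 0 b) := by
    have := intervalIntegral.continuousOn_primitive_interval' ha left_mem_uIcc
    rwa [uIcc_of_le hb] at this
  have hFc : ContinuousOn F (Icc 0 b) := by
    have := intervalIntegral.continuousOn_primitive_interval' hau left_mem_uIcc
    rw [uIcc_of_le hb] at this
    exact continuousOn_const.add this
  have hAd : ∀ s ∈ Icc 0 b, ∀ t ∈ Icc 0 b, A t - A s = ∫ r in s..t, a r := by
    intro s hs t ht
    exact intervalIntegral.integral_interval_sub_left (hsub _ ha _ h0 _ ht) (hsub _ ha _ h0 _ hs)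
  have hFd : ∀ s ∈ Icc 0 b, ∀ t ∈ Icc 0 b, F t - F s = ∫ r in s..t, a r * u r := by
    intro s hs t ht
    rw [← intervalIntegral.integral_interval_sub_left (hsub _ hau _ h0 _ ht) (hsub _ hau _ h0 _ hs)]
    simp only [hF]; ring
  have hAm : ∀ s ∈ Icc 0 b, ∀ t ∈ Icc 0 b, s ≤ t → A s ≤ A t := by
    intro s hs t ht hst
    have : 0 ≤ A t - A s := by
      rw [hAd s hs t ht]
      exact intervalIntegral.integral_nonneg hst
        (fun r hr => ha0 r ⟨hs.1.trans hr.1, hr.2.trans ht.2⟩)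
    linarith
  have hFm : ∀ s ∈ Icc 0 b, ∀ t ∈ Icc 0 b, s ≤ t → F s ≤ F t := by
    intro s hs t ht hst
    have : 0 ≤ F t - F s := by
      rw [hFd s hs t ht]
      exact intervalIntegral.integral_nonneg hst
        (fun r hr => mul_nonneg (ha0 r ⟨hs.1.trans hr.1, hr.2.trans ht.2⟩)
          (hu0 r ⟨hs.1.trans hr.1, hr.2.trans ht.2⟩))
    linarith
  have hF0 : F 0 = c := by simp [hF]
  have hA0 : A 0 = 0 := by simp [hA]
  have hstep : ∀ s ∈ Icc 0 b, ∀ t ∈ Icc 0 b, s ≤ t → F t - F s ≤ (A t - A s) * F t := by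
    intro s hs t ht hst
    rw [hFd s hs t ht, hAd s hs t ht, ← intervalIntegral.integral_mul_const]
    refine intervalIntegral.integral_mono_on hst (hsub _ hau _ hs _ ht)
      ((hsub _ ha _ hs _ ht).mul_const _) ?_
    intro r hr
    have hr' : r ∈ Icc 0 b := ⟨hs.1.trans hr.1, hr.2.trans ht.2⟩
    exact mul_le_mul_of_nonneg_left ((h r hr').trans (hFm r hr' t ht hr.2)) (ha0 r hr')
  have key : ∀ ε : ℝ, 0 < ε → ∀ s ∈ Icc 0 b, F s ≤ c * Real.exp ((1 + ε) * A s) := by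
    intro ε hε
    have hcl : IsClosed ({s | F s ≤ c * Real.exp ((1 + ε) * A s)} ∩ Icc 0 b) := by
      have : IsClosed {s ∈ Icc 0 b | F s ≤ c * Real.exp ((1 + ε) * A s)} :=
        isClosed_Icc.isClosed_le hFc
          (continuousOn_const.mul (Real.continuous_exp.comp_continuousOn
            (continuousOn_const.mul hAc)))
      convert this using 1
      ext s; simp [and_comm]
    refine hcl.Icc_subset_of_forall_exists_gt (by simp [hF0, hA0]) ?_
    rintro s ⟨hs, hsb⟩ y hy
    have hs' : s ∈ Icc 0 b := ⟨hsb.1, hsb.2.le⟩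
    have hδ : 0 < ε / (1 + ε) := by positivity
    have hev : ∀ᶠ t in 𝓝[Icc 0 b] s, A t < A s + ε / (1 + ε) :=
      (hAc s hs').eventually (gt_mem_nhds (by linarith))
    have hle : 𝓝[>] s ≤ 𝓝[Icc 0 b] s := by
      rw [← nhdsWithin_Ioo_eq_nhdsGT hsb.2]
      exact nhdsWithin_mono _ (fun r hr => ⟨hsb.1.trans hr.1.le, hr.2.le⟩)
    have hev2 : ∀ᶠ t in 𝓝[>] s, t ∈ Ioc s (min y b) :=
      Ioc_mem_nhdsGT (lt_min hy hsb.2)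
    obtain ⟨t, ht1, ht2⟩ := ((hev.filter_mono hle).and hev2).exists
    refine ⟨t, ?_, ht2.1, ht2.2.trans (min_le_left _ _)⟩
    have ht' : t ∈ Icc 0 b := ⟨hsb.1.trans ht2.1.le, ht2.2.trans (min_le_right _ _)⟩
    have h1 := hstep s hs' t ht' ht2.1.le
    have h2 := hAm s hs' t ht' ht2.1.le
    set x := A t - A s with hx
    have hx0 : 0 ≤ x := by linarith
    have hx1 : x ≤ ε / (1 + ε) := by linarith
    have hx2 : (1 + ε) * x ≤ ε := by
      rw [le_div_iff₀ (by positivity)] at hx1; linarith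
    have hx3 : x < 1 := lt_of_le_of_lt hx1 (by rw [div_lt_one (by positivity)]; linarith)
    have h3 : 1 ≤ (1 - x) * Real.exp ((1 + ε) * x) := by
      have := Real.add_one_le_exp ((1 + ε) * x)
      have h4 : (1 - x) * ((1 + ε) * x + 1) ≤ (1 - x) * Real.exp ((1 + ε) * x) :=
        mul_le_mul_of_nonneg_left this (by linarith)
      nlinarith
    have hFt : 0 ≤ F t := by
      have := hFm 0 h0 t ht' ht'.1
      linarith
    have he : Real.exp ((1 + ε) * A t) = Real.exp ((1 + ε) * A s) * Real.exp ((1 + ε) * x) := by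
      rw [← Real.exp_add]; congr 1; rw [hx]; ring
    have hs2 : F s ≤ c * Real.exp ((1 + ε) * A s) := hs
    change F t ≤ c * Real.exp ((1 + ε) * A t)
    calc F t ≤ F t * ((1 - x) * Real.exp ((1 + ε) * x)) := le_mul_of_one_le_right hFt h3
      _ = (F t - x * F t) * Real.exp ((1 + ε) * x) := by ring
      _ ≤ F s * Real.exp ((1 + ε) * x) := by gcongr; linarith
      _ ≤ (c * Real.exp ((1 + ε) * A s)) * Real.exp ((1 + ε) * x) := by gcongr
      _ = _ := by rw [he]; ring
  intro s hs
  have hlim : Tendsto (fun ε : ℝ => c * Real.exp ((1 + ε) * A s)) (𝓝[>] 0)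
      (𝓝 (c * Real.exp ((1 + 0) * A s))) := by
    refine Tendsto.mono_left (Continuous.tendsto ?_ 0) nhdsWithin_le_nhds
    fun_prop
  rw [add_zero, one_mul] at hlim
  refine (h s hs).trans (ge_of_tendsto hlim ?_)
  filter_upwards [self_mem_nhdsWithin] with ε hε
  exact key ε hε s hs

theorem aux_bdd {s : ℕ} {v : E3 → E3} (hv : MemC0 s v) {k : ℕ} (hk : k ≤ s) :
    BddAbove (range fun x => ‖iteratedFDeriv ℝ k v x‖) := by
  have hc : Continuous (fun x => ‖iteratedFDeriv ℝ k v x‖) :=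
    (hv.1.continuous_iteratedFDeriv (by exact_mod_cast hk)).norm
  let f : ZeroAtInftyContinuousMap E3 ℝ := ⟨⟨_, hc⟩, hv.2 k hk⟩
  exact f.isBounded_range.bddAbove

theorem aux_sup_nonneg (k : ℕ) (v : E3 → E3) : 0 ≤ supDeriv k v :=
  Real.iSup_nonneg fun _ => norm_nonneg _

theorem aux_le {v : E3 → E3} (hv : MemC0 2 v) (x : E3) : ‖v x‖ ≤ normS 2 v := by
  have h := le_ciSup (aux_bdd hv (k := 0) (by norm_num)) x
  simp only [norm_iteratedFDeriv_zero] at h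
  have h0 : ‖v x‖ ≤ supDeriv 0 v := by
    simpa [supDeriv] using h
  simp only [normS, Finset.sum_range_succ, Finset.sum_range_zero]
  have := aux_sup_nonneg 1 v
  have := aux_sup_nonneg 2 v
  linarith

theorem aux_lip {v : E3 → E3} (hv : MemC0 2 v) (x y : E3) :
    ‖v x - v y‖ ≤ normS 2 v * ‖x - y‖ := by
  have hd : Differentiable ℝ v := hv.1.differentiable (by norm_num)
  refine Convex.norm_image_sub_le_of_norm_fderiv_le (s := univ) (𝕜 := ℝ)
    (fun z _ => hd z) (fun z _ => ?_) convex_univ (mem_univ _) (mem_univ _)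
  have h := le_ciSup (aux_bdd hv (k := 1) (by norm_num)) z
  have h0 : ‖fderiv ℝ v z‖ ≤ supDeriv 1 v := by
    rw [← norm_iteratedFDeriv_one]; exact h
  simp only [normS, Finset.sum_range_succ, Finset.sum_range_zero]
  have := aux_sup_nonneg 0 v
  have := aux_sup_nonneg 2 v
  linarith

theorem aux_normS1 {v : E3 → E3} {C L : ℝ} (hL : 0 ≤ L)
    (h0 : ∀ x, ‖v x‖ ≤ C) (h1 : ∀ x y, ‖v x - v y‖ ≤ L * ‖x - y‖) : normS 1 v ≤ C + L := by
  simp only [normS, Finset.sum_range_succ, Finset.sum_range_zero, zero_add]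
  refine add_le_add (ciSup_le fun x => ?_) (ciSup_le fun x => ?_)
  · rw [norm_iteratedFDeriv_zero]; exact h0 x
  · rw [norm_iteratedFDeriv_one]
    exact norm_fderiv_le_of_lip' ℝ hL (Eventually.of_forall fun z => h1 z x)

/-- **Lemma 7.5 (a priori bound `B_j` on solutions of the control system).**
Any solution of the control system on `[0,T₀] ⊆ [0,T]` satisfies
`‖φ(t) − id‖_{1,∞} ≤ B_j` and `‖φ(t)⁻¹ − id‖_{1,∞} ≤ B_j`, with
`B_j = (2c_V/ω)‖j‖_{L¹} exp((c_V/ω)‖j‖_{L¹})`. -/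
theorem solution_a_priori_bound
    {V : Type*} [NormedAddCommGroup V] [InnerProductSpace ℝ V] [CompleteSpace V]
    [TopologicalSpace.SeparableSpace V]
    (emb : V →ₗ[ℝ] (E3 → E3)) (cV : ℝ) (hcV : 0 < cV)
    (hembC0 : ∀ u : V, MemC0 2 (emb u))
    (hembBound : ∀ u : V, normS 2 (emb u) ≤ cV * ‖u‖)
    (ω : ℝ) (hω : 0 < ω)
    (A : DiffId 1 → V →L[ℝ] V →L[ℝ] ℝ)
    (hAsymm : ∀ (φ : DiffId 1) (u w : V), A φ u w = A φ w u)
    (hApos : ∀ (φ : DiffId 1) (u : V), 0 ≤ A φ u u)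
    (hAlip : ∀ φ₀ : DiffId 1, ∃ r > 0, ∃ ℓ > 0, ∀ φ ψ : DiffId 1,
      distS 1 φ φ₀ ≤ r → distS 1 ψ φ₀ ≤ r → ‖A φ - A ψ‖ ≤ ℓ * distS 1 φ ψ)
    (T : ℝ) (hT : 0 < T)
    (j : ℝ → V →L[ℝ] ℝ) (hj : IntegrableOn j (Icc 0 T))
    (T₀ : ℝ) (hT₀0 : 0 ≤ T₀) (hT₀T : T₀ ≤ T)
    (φ : ℝ → DiffId 1) (v : ℝ → V)
    (hsol : IsSolution emb ω A j T₀ φ v) :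
    ∀ t ∈ Icc (0 : ℝ) T₀,
      normS 1 (fun x => φ t x - x) ≤
        2 * cV / ω * (∫ s in (0 : ℝ)..T, ‖j s‖) *
          Real.exp (cV / ω * ∫ s in (0 : ℝ)..T, ‖j s‖) ∧
      normS 1 (fun x => (φ t).invFun x - x) ≤
        2 * cV / ω * (∫ s in (0 : ℝ)..T, ‖j s‖) *
          Real.exp (cV / ω * ∫ s in (0 : ℝ)..T, ‖j s‖) := by
  obtain ⟨hvel, hint, -⟩ := hsol
  have hvb : ∀ t ∈ Icc (0:ℝ) T₀, normS 2 (emb (v t)) ≤ cV / ω * ‖j t‖ := by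
    intro t ht
    have h1 := hvel t ht (v t)
    rw [real_inner_self_eq_norm_sq] at h1
    have h2 := hApos (φ t) (v t)
    have h3 := (le_abs_self _).trans ((j t).le_opNorm (v t))
    have h4 : ω * ‖v t‖ ≤ ‖j t‖ := by
      rcases eq_or_lt_of_le (norm_nonneg (v t)) with h | h
      · rw [← h, mul_zero]; exact norm_nonneg _
      · refine le_of_mul_le_mul_right ?_ h
        nlinarith
    refine (hembBound _).trans ?_
    rw [div_mul_eq_mul_div, le_div_iff₀ hω]
    nlinarith
  set a : ℝ → ℝ := fun s => cV / ω * ‖j s‖ with ha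
  have ha0 : ∀ s, 0 ≤ a s := fun s => by positivity
  have haT : IntervalIntegrable a volume 0 T := by
    refine IntervalIntegrable.const_mul ?_ _
    rw [intervalIntegrable_iff_integrableOn_Icc_of_le hT.le]
    exact hj.norm
  have hJ : cV / ω * (∫ s in (0:ℝ)..T, ‖j s‖) = ∫ s in (0:ℝ)..T, a s := by
    rw [ha, intervalIntegral.integral_const_mul]
  set J := ∫ s in (0:ℝ)..T, a s with hJdef
  have hJ0 : 0 ≤ J := intervalIntegral.integral_nonneg hT.le fun s _ => ha0 s
  have hB : 2 * cV / ω * (∫ s in (0:ℝ)..T, ‖j s‖) = 2 * J := by rw [← hJ]; ring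
  rw [hB, hJ]
  intro t ht
  have h0t : 0 ≤ t := ht.1
  have htT : t ≤ T := ht.2.trans hT₀T
  have hai : ∀ p ∈ Icc 0 t, ∀ q ∈ Icc 0 t, IntervalIntegrable a volume p q := by
    intro p hp q hq
    refine haT.mono_set ?_
    rw [uIcc_of_le hT.le]
    exact uIcc_subset_Icc ⟨hp.1, hp.2.trans htT⟩ ⟨hq.1, hq.2.trans htT⟩
  have m0 : (0:ℝ) ∈ Icc 0 t := ⟨le_rfl, h0t⟩
  have mt : t ∈ Icc 0 t := ⟨h0t, le_rfl⟩
  have haJ : ∀ p ∈ Icc 0 t, ∀ q ∈ Icc 0 t, p ≤ q → ∫ s in p..q, a s ≤ J := by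
    intro p hp q hq hpq
    exact intervalIntegral.integral_mono_interval hp.1 hpq (hq.2.trans htT)
      (Eventually.of_forall fun s => ha0 s) haT
  have hmem : ∀ s ∈ Icc 0 t, s ∈ Icc 0 T₀ := fun s hs => ⟨hs.1, hs.2.trans ht.2⟩
  have hexp : 1 ≤ Real.exp J := Real.one_le_exp hJ0
  -- sup bound
  have hsup : ∀ x, ‖φ t x - x‖ ≤ J := by
    intro x
    rw [(hint t ht x).2, add_sub_cancel_left]
    refine (intervalIntegral.norm_integral_le_of_norm_le h0t (g := a) ?_ (hai _ m0 _ mt)).trans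
      (haJ _ m0 _ mt h0t)
    refine Eventually.of_forall fun s hs => ?_
    exact (aux_le (hembC0 _) _).trans (hvb s (hmem s ⟨hs.1.le, hs.2⟩))
  -- differences
  have hmain : ∀ x y, ‖(φ t x - x) - (φ t y - y)‖ ≤ J * Real.exp J * ‖x - y‖ ∧
      ‖(φ t x - x) - (φ t y - y)‖ ≤ J * Real.exp J * ‖φ t x - φ t y‖ := by
    intro x y
    set f : ℝ → E3 := fun s => emb (v s) (φ s x) - emb (v s) (φ s y) with hf
    set w : ℝ → E3 := fun s => φ s x - φ s y with hw
    have hfi : IntervalIntegrable f volume 0 t := (hint t ht x).1.sub (hint t ht y).1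
    have hfi' : ∀ p ∈ Icc 0 t, ∀ q ∈ Icc 0 t, IntervalIntegrable f volume p q := by
      intro p hp q hq
      refine hfi.mono_set ?_
      rw [uIcc_of_le h0t]
      exact uIcc_subset_Icc hp hq
    have hwe : ∀ s ∈ Icc 0 t, w s = (x - y) + ∫ r in (0:ℝ)..s, f r := by
      intro s hs
      have hx := hint s (hmem s hs) x
      have hy := hint s (hmem s hs) y
      simp only [hw, hf]
      rw [intervalIntegral.integral_sub hx.1 hy.1, hx.2, hy.2]
      abel
    have hwc : ContinuousOn w (Icc 0 t) := by
      have := intervalIntegral.continuousOn_primitive_interval' hfi left_mem_uIcc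
      rw [uIcc_of_le h0t] at this
      exact (continuousOn_const.add this).congr hwe
    have hnc : ContinuousOn (fun s => ‖w s‖) (Icc 0 t) := hwc.norm
    have hfb : ∀ s ∈ Icc 0 t, ‖f s‖ ≤ a s * ‖w s‖ := by
      intro s hs
      refine (aux_lip (hembC0 _) _ _).trans ?_
      exact mul_le_mul_of_nonneg_right (hvb s (hmem s hs)) (norm_nonneg _)
    have hawi : ∀ p ∈ Icc 0 t, ∀ q ∈ Icc 0 t,
        IntervalIntegrable (fun s => a s * ‖w s‖) volume p q := by
      intro p hp q hq
      exact (hai p hp q hq).mul_continuousOn (hnc.mono (uIcc_subset_Icc hp hq))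
    have hfI : ∀ p ∈ Icc 0 t, ∀ q ∈ Icc 0 t, p ≤ q →
        ‖∫ r in p..q, f r‖ ≤ ∫ r in p..q, a r * ‖w r‖ := by
      intro p hp q hq hpq
      refine intervalIntegral.norm_integral_le_of_norm_le hpq ?_ (hawi p hp q hq)
      exact Eventually.of_forall fun s hs => hfb s ⟨hp.1.trans hs.1.le, hs.2.trans hq.2⟩
    have hfin : ∀ c : ℝ, 0 ≤ c → (∀ s ∈ Icc 0 t, ‖w s‖ ≤ c * Real.exp J) →
        ‖(φ t x - x) - (φ t y - y)‖ ≤ J * Real.exp J * c := by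
      intro c hc hwb
      have e : (φ t x - x) - (φ t y - y) = ∫ r in (0:ℝ)..t, f r := by
        have := hwe t mt
        rw [← sub_eq_iff_eq_add'] at this
        rw [← this]; simp only [hw]; abel
      rw [e]
      refine (hfI _ m0 _ mt h0t).trans ?_
      calc ∫ r in (0:ℝ)..t, a r * ‖w r‖ ≤ ∫ r in (0:ℝ)..t, a r * (c * Real.exp J) := by
            refine intervalIntegral.integral_mono_on h0t (hawi _ m0 _ mt)
              ((hai _ m0 _ mt).mul_const _) fun r hr => ?_
            exact mul_le_mul_of_nonneg_left (hwb r hr) (ha0 r)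
        _ = (∫ r in (0:ℝ)..t, a r) * (c * Real.exp J) := intervalIntegral.integral_mul_const _ _
        _ ≤ J * (c * Real.exp J) := by
            exact mul_le_mul_of_nonneg_right (haJ _ m0 _ mt h0t) (by positivity)
        _ = _ := by ring
    constructor
    · refine hfin _ (norm_nonneg _) fun s hs => ?_
      refine (aux_gronwall a (fun s => ‖w s‖) t ‖x - y‖ h0t (norm_nonneg _) (hai _ m0 _ mt)
        (fun s _ => ha0 s) hnc (fun s _ => norm_nonneg _) ?_ s hs).trans ?_
      · intro s hs
        change ‖w s‖ ≤ _
        rw [hwe s hs]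
        exact (norm_add_le _ _).trans (add_le_add le_rfl (hfI _ m0 _ hs hs.1))
      · have := haJ _ m0 _ hs hs.1
        gcongr
    · refine hfin _ (norm_nonneg _) fun s hs => ?_
      have hr : ∀ s ∈ Icc 0 t, t - s ∈ Icc 0 t := fun s hs =>
        ⟨by linarith [hs.2], by linarith [hs.1]⟩
      have hg := aux_gronwall (fun s => a (t - s)) (fun s => ‖w (t - s)‖) t ‖w t‖ h0t
        (norm_nonneg _) ?_ (fun s _ => ha0 _) ?_ (fun s _ => norm_nonneg _) ?_ (t - s) (hr s hs)
      · simp only [sub_sub_cancel] at hg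
        rw [intervalIntegral.integral_comp_sub_left (fun s => a s)] at hg
        simp only [sub_sub_cancel, sub_zero] at hg
        refine hg.trans ?_
        have := haJ _ hs _ mt hs.2
        gcongr
      · have := (hai _ m0 _ mt).comp_sub_left t
        simp only [sub_zero, sub_self] at this
        exact this.symm
      · exact hnc.comp (continuousOn_const.sub continuousOn_id) hr
      · intro s hs
        rw [intervalIntegral.integral_comp_sub_left (fun s => a s * ‖w s‖), sub_zero]
        have hs' := hr s hs
        have e : w (t - s) = w t - ∫ r in (t - s)..t, f r := by
          rw [hwe _ hs', hwe t mt, ← intervalIntegral.integral_interval_sub_left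
            (hfi' _ m0 _ mt) (hfi' _ m0 _ hs')]
          abel
        change ‖w (t - s)‖ ≤ _
        rw [e]
        exact (norm_sub_le _ _).trans (add_le_add le_rfl (hfI _ hs' _ mt hs'.2))
  have hLn : 0 ≤ J * Real.exp J := by positivity
  have hle : J + J * Real.exp J ≤ 2 * J * Real.exp J := by nlinarith
  refine ⟨(aux_normS1 hLn hsup fun x y => (hmain x y).1).trans hle,
    (aux_normS1 (C := J) hLn (fun x => ?_) fun x y => ?_).trans hle⟩
  · have := hsup ((φ t).invFun x)
    rwa [(φ t).right_inv x, norm_sub_rev] at this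
  · have := (hmain ((φ t).invFun x) ((φ t).invFun y)).2
    rw [(φ t).right_inv x, (φ t).right_inv y] at this
    refine le_trans (le_of_eq ?_) this
    rw [← norm_neg]; congr 1; abel

end
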